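/- Let R be a commutative Noetherian ring of prime characteristic p > 0, let s > 1 be a real number, and let I be an ideal of R. If n and r are natural numbers with r ≥ (μ(I) − 1 − n(s − 1))/s, then the weak s-closure of I^{n+r} is contained in the tight closure (I^n)*. In particular, if n ≥ (μ(I) − 1)/(s − 1), then the weak s-closure of I^n equals (I^n)*. -/

import Mathlib

open Pointwise

/-- `R°`: the set of elements of `R` not contained in any minimal prime of `R`. -/
def RCirc (R : Type*) [CommRing R] : Set R :=
  {c | ∀ P ∈ minimalPrimes R, c ∉ P}

/-- The `q`-th Frobenius power `I^[q]` of an ideal `I`, generated by `q`-th powers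
of elements of `I`. -/
def frobPow {R : Type*} [CommRing R] (I : Ideal R) (q : ℕ) : Ideal R :=
  Ideal.span ((fun f => f ^ q) '' (I : Set R))

/-- The `(s,q)` mixed power `I^(s,q) = I^⌈sq⌉ + I^[q]`. -/
noncomputable def mixedPow {R : Type*} [CommRing R] (I : Ideal R) (s : ℝ) (q : ℕ) : Ideal R :=
  I ^ ⌈s * (q : ℝ)⌉₊ + frobPow I q

/-- The weak `s`-closure of `I`: elements `x` such that there is `c ∈ R°` with
`c·x^q ∈ I^(s,q)` for all sufficiently large powers `q = p^e` of `p`. -/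
def weakCl {R : Type*} [CommRing R] (p : ℕ) (I : Ideal R) (s : ℝ) : Set R :=
  {x | ∃ c ∈ RCirc R, ∃ N : ℕ, ∀ e : ℕ, N ≤ e → c * x ^ p ^ e ∈ mixedPow I s (p ^ e)}

/-- The tight closure `I*` of `I`. -/
def tightCl {R : Type*} [CommRing R] (p : ℕ) (I : Ideal R) : Set R :=
  {x | ∃ c ∈ RCirc R, ∃ N : ℕ, ∀ e : ℕ, N ≤ e → c * x ^ p ^ e ∈ frobPow I (p ^ e)}

/-- The integral closure of `I`: elements `x` such that there is `c ∈ R°` with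
`c·x^n ∈ I^n` for all sufficiently large `n`. -/
def intCl {R : Type*} [CommRing R] (I : Ideal R) : Set R :=
  {x | ∃ c ∈ RCirc R, ∃ N : ℕ, ∀ n : ℕ, N ≤ n → c * x ^ n ∈ I ^ n}

/-- The `α`-th rational power `I_α` of `I`, for rational `α = a/b ≥ 0`:
elements `x` with `x^b` in the integral closure of `I^a`. -/
noncomputable def ratPow {R : Type*} [CommRing R] (I : Ideal R) (α : ℚ) : Set R :=
  {x | x ^ α.den ∈ intCl (I ^ α.num.toNat)}

/-- `μ(I)`: the minimal number of generators of `I`. -/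
noncomputable def mu {R : Type*} [CommRing R] (I : Ideal R) : ℕ :=
  sInf {m : ℕ | ∃ s : Finset R, s.card = m ∧ Ideal.span (s : Set R) = I}

/-- An ideal has positive height if it is not contained in any minimal prime. -/
def PosHeight {R : Type*} [CommRing R] (I : Ideal R) : Prop :=
  ∀ P ∈ minimalPrimes R, ¬ I ≤ P

theorem frobPow_mono {R : Type*} [CommRing R] {I J : Ideal R} (h : I ≤ J) (q : ℕ) :
    frobPow I q ≤ frobPow J q :=
  Ideal.span_mono (Set.image_mono h)

theorem exists_gens {R : Type*} [CommRing R] [IsNoetherianRing R] (I : Ideal R) :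
    ∃ T : Finset R, T.card = mu I ∧ Ideal.span (T : Set R) = I := by
  have : mu I ∈ {m : ℕ | ∃ s : Finset R, s.card = m ∧ Ideal.span (s : Set R) = I} := by
    apply Nat.sInf_mem
    obtain ⟨T, hT⟩ := (isNoetherianRing_iff_ideal_fg R).1 inferInstance I
    exact ⟨T.card, T, rfl, hT⟩
  exact this

theorem pow_le_frobPow {R : Type*} [CommRing R] (T : Finset R) (n q N : ℕ) (hq : 0 < q)
    (hN : q * (n + T.card) < N + T.card + q) :
    Ideal.span (T : Set R) ^ N ≤ frobPow (Ideal.span (T : Set R) ^ n) q := by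
  classical
  have hspan : Ideal.span (T : Set R) ^ N = Ideal.span ((T : Set R) ^ N) := Submodule.span_pow _ _
  rw [hspan, Ideal.span_le]
  intro x hx
  obtain ⟨f, rfl⟩ := Set.mem_pow.1 hx
  rw [List.prod_ofFn]
  set a : R → ℕ := fun t => (Finset.univ.filter (fun i => (f i : R) = t)).card with ha
  have hmaps : ∀ i ∈ (Finset.univ : Finset (Fin N)), (f i : R) ∈ T := fun i _ => (f i).2
  have hprod : (∏ i, (f i : R)) = ∏ t ∈ T, t ^ a t := by
    rw [← Finset.prod_fiberwise_of_maps_to hmaps]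
    apply Finset.prod_congr rfl
    intro t _
    rw [ha]
    apply Finset.prod_eq_pow_card
    intro i hi
    exact (Finset.mem_filter.1 hi).2
  have hsum : ∑ t ∈ T, a t = N := by
    have := Finset.card_eq_sum_card_fiberwise hmaps
    simpa using this.symm
  rw [hprod]
  have hsplit : ∏ t ∈ T, t ^ a t = (∏ t ∈ T, t ^ (a t % q)) * (∏ t ∈ T, t ^ (a t / q)) ^ q := by
    rw [← Finset.prod_pow, ← Finset.prod_mul_distrib]
    apply Finset.prod_congr rfl
    intro t _
    rw [← pow_mul, ← pow_add, mul_comm, Nat.mod_add_div]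
  rw [hsplit]
  apply Ideal.mul_mem_left
  apply Ideal.subset_span
  refine ⟨_, ?_, rfl⟩
  have hn : n ≤ ∑ t ∈ T, a t / q := by
    have h1 : ∑ t ∈ T, (a t + 1) ≤ ∑ t ∈ T, (q * (a t / q) + q) := by
      apply Finset.sum_le_sum
      intro t _
      have := Nat.mod_add_div (a t) q
      have := Nat.mod_lt (a t) hq
      omega
    simp only [Finset.sum_add_distrib, Finset.sum_const, smul_eq_mul, ← Finset.mul_sum, hsum] at h1
    have h2 : q * n < q * (∑ t ∈ T, a t / q + 1) := by nlinarith
    have := Nat.lt_of_mul_lt_mul_left h2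
    omega
  apply Ideal.pow_le_pow_right hn
  rw [← Finset.prod_pow_eq_pow_sum]
  apply Ideal.prod_mem_prod
  intro t ht
  exact Ideal.pow_mem_pow (Ideal.subset_span ht) _

theorem mixedPow_le {R : Type*} [CommRing R] [IsNoetherianRing R]
    (s : ℝ) (hs : 1 < s) (I : Ideal R) (n r q : ℕ) (hq : 0 < q)
    (h : (mu I : ℝ) - 1 - (n : ℝ) * (s - 1) ≤ r * s) :
    mixedPow (I ^ (n + r)) s q ≤ frobPow (I ^ n) q := by
  apply sup_le _ (frobPow_mono (Ideal.pow_le_pow_right (Nat.le_add_right n r)) q)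
  obtain ⟨T, hT, rfl⟩ := exists_gens I
  rw [← pow_mul]
  apply pow_le_frobPow T n q _ hq
  rw [← hT] at h
  have hc := Nat.le_ceil (s * (q : ℝ))
  have hq' : (0 : ℝ) < q := by exact_mod_cast hq
  set k := ⌈s * (q : ℝ)⌉₊
  have h3 : ((n : ℝ) + r) * (s * q) ≤ (n + r) * k := mul_le_mul_of_nonneg_left hc (by positivity)
  rcases Nat.eq_zero_or_pos T.card with h0 | h0
  · rw [h0]
    have hk : (q : ℝ) ≤ k := by nlinarith
    have hk' : q ≤ k := by exact_mod_cast hk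
    have : q * n ≤ (n + r) * k := by nlinarith [Nat.mul_le_mul hk' (Nat.le_add_right n r)]
    simp only [add_zero]
    omega
  · have h4 : (q : ℝ) * (n + T.card) ≤ (n + r) * k + q := by
      have := mul_le_mul_of_nonneg_right h hq'.le
      nlinarith
    have h5 : q * (n + T.card) ≤ (n + r) * k + q := by exact_mod_cast h4
    omega

theorem weakCl_sub {R : Type*} [CommRing R] [IsNoetherianRing R] (p : ℕ) (hp : p.Prime)
    (s : ℝ) (hs : 1 < s) (I : Ideal R) (n r : ℕ)
    (h : (mu I : ℝ) - 1 - (n : ℝ) * (s - 1) ≤ r * s) :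
    weakCl p (I ^ (n + r)) s ⊆ tightCl p (I ^ n) := by
  rintro x ⟨c, hc, N, hN⟩
  exact ⟨c, hc, N, fun e he => mixedPow_le s hs I n r _ (pow_pos hp.pos e) h (hN e he)⟩

/-- for `s > 1`: if `r ≥ (μ(I) − 1 − n(s − 1))/s`, then the weak `s`-closure
of `I^{n+r}` is contained in `(I^n)*`; in particular if `n ≥ (μ(I) − 1)/(s − 1)`, the weak
`s`-closure of `I^n` equals `(I^n)*`. -/
theorem stmt19 {R : Type*} [CommRing R] [IsNoetherianRing R]
    (p : ℕ) (hp : p.Prime) (hcp : CharP R p)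
    (s : ℝ) (hs : 1 < s) (I : Ideal R) :
    (∀ n r : ℕ, ((mu I : ℝ) - 1 - (n : ℝ) * (s - 1)) / s ≤ (r : ℝ) →
        weakCl p (I ^ (n + r)) s ⊆ tightCl p (I ^ n)) ∧
      (∀ n : ℕ, ((mu I : ℝ) - 1) / (s - 1) ≤ (n : ℝ) →
        weakCl p (I ^ n) s = tightCl p (I ^ n)) := by
  refine ⟨fun n r h => weakCl_sub p hp s hs I n r ((div_le_iff₀ (by linarith)).1 h), ?_⟩
  intro n h
  apply Set.Subset.antisymm
  · have h' := (div_le_iff₀ (by linarith)).1 h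
    exact weakCl_sub p hp s hs I n 0 (by push_cast; linarith)
  · rintro x ⟨c, hc, N, hN⟩
    exact ⟨c, hc, N, fun e he => (le_sup_right : frobPow (I ^ n) (p ^ e) ≤ _) (hN e he)⟩
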